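/- (Theorem 3, gambling regions lie on their side of the diagonal) For every (p1,p2) ∈ Φ_{B_1} one has p1 ≥ p2, and for every (p1,p2) ∈ Φ_{B_2} one has p1 ≤ p2. -/

import Mathlib

open Set

noncomputable section

/-- Belief update for an unobserved channel: `T p = λ0 + (λ1 - λ0) p`. -/
def Tr (l0 l1 p : ℝ) : ℝ := l0 + (l1 - l0) * p

/-- The four power allocation actions. -/
inductive PAct
  | Bb  -- balanced
  | B1  -- bet on channel 1
  | B2  -- bet on channel 2
  | Br  -- conservative

/-- Action-value functional `W_a` computed from a function `W`. -/
def Q (l0 l1 β Rl Rh Cl Ch : ℝ) (W : ℝ → ℝ → ℝ) : PAct → ℝ → ℝ → ℝ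
  | PAct.Bb => fun p1 p2 =>
      (p1 + p2) * (Rl + Cl) - 2 * Cl +
        β * ((1 - p1) * (1 - p2) * W l0 l0 + p1 * p2 * W l1 l1 +
             p1 * (1 - p2) * W l1 l0 + (1 - p1) * p2 * W l0 l1)
  | PAct.B1 => fun p1 p2 =>
      (Rh + Ch) * p1 - Ch +
        β * (p1 * W l1 (Tr l0 l1 p2) + (1 - p1) * W l0 (Tr l0 l1 p2))
  | PAct.B2 => fun p1 p2 =>
      (Rh + Ch) * p2 - Ch +
        β * (p2 * W (Tr l0 l1 p1) l1 + (1 - p2) * W (Tr l0 l1 p1) l0)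
  | PAct.Br => fun p1 p2 => β * W (Tr l0 l1 p1) (Tr l0 l1 p2)

/-- The Bellman operator `L W = max over the four actions of W_a`. -/
def Bop (l0 l1 β Rl Rh Cl Ch : ℝ) (W : ℝ → ℝ → ℝ) (p1 p2 : ℝ) : ℝ :=
  max (max (Q l0 l1 β Rl Rh Cl Ch W PAct.Bb p1 p2)
           (Q l0 l1 β Rl Rh Cl Ch W PAct.B1 p1 p2))
      (max (Q l0 l1 β Rl Rh Cl Ch W PAct.B2 p1 p2)
           (Q l0 l1 β Rl Rh Cl Ch W PAct.Br p1 p2))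

/-- Boundedness on the belief space `[0,1] × [0,1]`. -/
def BddOnSq (W : ℝ → ℝ → ℝ) : Prop :=
  ∃ M : ℝ, ∀ p1 ∈ Icc (0:ℝ) 1, ∀ p2 ∈ Icc (0:ℝ) 1, |W p1 p2| ≤ M

/-- Being a fixed point of the Bellman operator on the belief space. -/
def IsFix (l0 l1 β Rl Rh Cl Ch : ℝ) (V : ℝ → ℝ → ℝ) : Prop :=
  ∀ p1 ∈ Icc (0:ℝ) 1, ∀ p2 ∈ Icc (0:ℝ) 1,
    V p1 p2 = Bop l0 l1 β Rl Rh Cl Ch V p1 p2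

/-- Decision region of action `a`: beliefs where action `a` achieves the value. -/
def Phi (l0 l1 β Rl Rh Cl Ch : ℝ) (V : ℝ → ℝ → ℝ) (a : PAct) : Set (ℝ × ℝ) :=
  {p : ℝ × ℝ | p.1 ∈ Icc (0:ℝ) 1 ∧ p.2 ∈ Icc (0:ℝ) 1 ∧
    V p.1 p.2 = Q l0 l1 β Rl Rh Cl Ch V a p.1 p.2}


/-- Invariants propagated along value iteration. -/
structure VInv (l0 l1 A K : ℝ) (W : ℝ → ℝ → ℝ) : Prop where
  sym : ∀ x ∈ Icc (0:ℝ) 1, ∀ y ∈ Icc (0:ℝ) 1, W x y = W y x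
  conv : ∀ x ∈ Icc (0:ℝ) 1, ∀ y ∈ Icc (0:ℝ) 1, ∀ q ∈ Icc (0:ℝ) 1, ∀ w ∈ Icc (0:ℝ) 1,
    W (w * y + (1 - w) * x) q ≤ w * W y q + (1 - w) * W x q
  mono : ∀ x ∈ Icc (0:ℝ) 1, ∀ y ∈ Icc (0:ℝ) 1, ∀ q ∈ Icc (0:ℝ) 1, x ≤ y → W x q ≤ W y q
  lip : ∀ x ∈ Icc (0:ℝ) 1, ∀ y ∈ Icc (0:ℝ) 1, ∀ q ∈ Icc (0:ℝ) 1, x ≤ y →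
    W y q ≤ W x q + K * (y - x)
  dfc : ∀ c ∈ Icc (0:ℝ) 1, ∀ q, (q = l0 ∨ q = l1) →
    c * W l1 q + (1 - c) * W l0 q - W (Tr l0 l1 c) q ≤ (1 - c) * A

lemma Tr_mem {l0 l1 : ℝ} (hl0 : l0 ∈ Icc (0:ℝ) 1) (hl1 : l1 ∈ Icc (0:ℝ) 1)
    {p : ℝ} (hp : p ∈ Icc (0:ℝ) 1) : Tr l0 l1 p ∈ Icc (0:ℝ) 1 := by
  obtain ⟨a, b⟩ := hl0
  obtain ⟨c, d⟩ := hl1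
  obtain ⟨e, f⟩ := hp
  unfold Tr
  constructor <;> nlinarith

lemma comb_mem {x y w : ℝ} (hx : x ∈ Icc (0:ℝ) 1) (hy : y ∈ Icc (0:ℝ) 1)
    (hw : w ∈ Icc (0:ℝ) 1) : w * y + (1 - w) * x ∈ Icc (0:ℝ) 1 := by
  obtain ⟨a, b⟩ := hx
  obtain ⟨c, d⟩ := hy
  obtain ⟨e, f⟩ := hw
  constructor <;> nlinarith

/-- weighted averages are monotone -/
lemma avg_le {t a b a' b' : ℝ} (ht : t ∈ Icc (0:ℝ) 1) (ha : a ≤ a') (hb : b ≤ b') :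
    t * a + (1 - t) * b ≤ t * a' + (1 - t) * b' := by
  have h1 := mul_le_mul_of_nonneg_left ha ht.1
  have h2 := mul_le_mul_of_nonneg_left hb (sub_nonneg.2 ht.2)
  linarith

lemma Bop_le_iff {l0 l1 β Rl Rh Cl Ch : ℝ} {W : ℝ → ℝ → ℝ} {p1 p2 t : ℝ} :
    Bop l0 l1 β Rl Rh Cl Ch W p1 p2 ≤ t ↔
      ∀ a, Q l0 l1 β Rl Rh Cl Ch W a p1 p2 ≤ t := by
  unfold Bop
  constructor
  · intro h a
    simp only [max_le_iff] at h
    cases a <;> tauto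
  · intro h
    simp only [max_le_iff]
    exact ⟨⟨h _, h _⟩, h _, h _⟩

lemma Q_le_Bop {l0 l1 β Rl Rh Cl Ch : ℝ} {W : ℝ → ℝ → ℝ} {p1 p2 : ℝ} (a : PAct) :
    Q l0 l1 β Rl Rh Cl Ch W a p1 p2 ≤ Bop l0 l1 β Rl Rh Cl Ch W p1 p2 :=
  Bop_le_iff.1 le_rfl a

section
variable {l0 l1 β Rl Rh Cl Ch A K : ℝ} {W : ℝ → ℝ → ℝ}

lemma VInv.conv2 (h : VInv l0 l1 A K W) {x y q w : ℝ} (hx : x ∈ Icc (0:ℝ) 1)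
    (hy : y ∈ Icc (0:ℝ) 1) (hq : q ∈ Icc (0:ℝ) 1) (hw : w ∈ Icc (0:ℝ) 1) :
    W q (w * y + (1 - w) * x) ≤ w * W q y + (1 - w) * W q x := by
  rw [h.sym q hq _ (comb_mem hx hy hw), h.sym q hq y hy, h.sym q hq x hx]
  exact h.conv x hx y hy q hq w hw

lemma VInv.convT (h : VInv l0 l1 A K W) (hl0 : l0 ∈ Icc (0:ℝ) 1) (hl1 : l1 ∈ Icc (0:ℝ) 1)
    {q w : ℝ} (hq : q ∈ Icc (0:ℝ) 1) (hw : w ∈ Icc (0:ℝ) 1) :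
    W (Tr l0 l1 w) q ≤ w * W l1 q + (1 - w) * W l0 q := by
  have := h.conv l0 hl0 l1 hl1 q hq w hw
  rwa [show w * l1 + (1 - w) * l0 = Tr l0 l1 w by unfold Tr; ring] at this

lemma VInv.convT2 (h : VInv l0 l1 A K W) (hl0 : l0 ∈ Icc (0:ℝ) 1) (hl1 : l1 ∈ Icc (0:ℝ) 1)
    {q w : ℝ} (hq : q ∈ Icc (0:ℝ) 1) (hw : w ∈ Icc (0:ℝ) 1) :
    W q (Tr l0 l1 w) ≤ w * W q l1 + (1 - w) * W q l0 := by
  have := h.conv2 hl0 hl1 hq hw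
  rwa [show w * l1 + (1 - w) * l0 = Tr l0 l1 w by unfold Tr; ring] at this

/-- learning channel 2 versus learning channel 1 -/
lemma VInv.learn (h : VInv l0 l1 A K W) (hl0 : l0 ∈ Icc (0:ℝ) 1) (hl1 : l1 ∈ Icc (0:ℝ) 1)
    {p1 p2 : ℝ} (hp1 : p1 ∈ Icc (0:ℝ) 1) (hp2 : p2 ∈ Icc (0:ℝ) 1) (hlt : p1 < p2) :
    p1 * W l1 (Tr l0 l1 p2) + (1 - p1) * W l0 (Tr l0 l1 p2) ≤
    p2 * W (Tr l0 l1 p1) l1 + (1 - p2) * W (Tr l0 l1 p1) l0 + (p2 - p1) * A := by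
  have hT1 := Tr_mem hl0 hl1 hp1
  have hT2 := Tr_mem hl0 hl1 hp2
  have hpos : 0 < 1 - p1 := by linarith [hp2.2]
  obtain ⟨v, hv⟩ : ∃ v, v = (p2 - p1) / (1 - p1) := ⟨_, rfl⟩
  have hv0 : 0 ≤ v := by rw [hv]; exact div_nonneg (by linarith) hpos.le
  have hv1 : v ≤ 1 := by rw [hv, div_le_one hpos]; linarith [hp2.2]
  have hvm : v * (1 - p1) = p2 - p1 := by rw [hv]; field_simp
  have hc : v * l1 + (1 - v) * Tr l0 l1 p1 = Tr l0 l1 p2 := by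
    unfold Tr; linear_combination (l1 - l0) * hvm
  have e1 := h.conv _ hT1 _ hl1 l1 hl1 v ⟨hv0, hv1⟩
  have e0 := h.conv _ hT1 _ hl1 l0 hl0 v ⟨hv0, hv1⟩
  rw [hc] at e1 e0
  have hd := mul_le_mul_of_nonneg_left (h.dfc p1 hp1 l1 (Or.inr rfl)) hv0
  rw [h.sym l1 hl1 _ hT2, h.sym l0 hl0 _ hT2]
  refine (avg_le hp1 e1 e0).trans ?_
  rw [h.sym l0 hl0 l1 hl1] at hd
  have hp2e : p2 = p1 + v * (1 - p1) := by linarith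
  subst hp2e
  nlinarith [hd]

lemma Q_B1_le_B2 (h : VInv l0 l1 (Rh + Ch) K W) (hl0 : l0 ∈ Icc (0:ℝ) 1)
    (hl1 : l1 ∈ Icc (0:ℝ) 1) (hβ0 : 0 ≤ β)
    {p1 p2 : ℝ} (hp1 : p1 ∈ Icc (0:ℝ) 1) (hp2 : p2 ∈ Icc (0:ℝ) 1) (hlt : p1 < p2) :
    Q l0 l1 β Rl Rh Cl Ch W PAct.B1 p1 p2 + (p2 - p1) * (Rh + Ch) * (1 - β) ≤
    Q l0 l1 β Rl Rh Cl Ch W PAct.B2 p1 p2 := by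
  have := mul_le_mul_of_nonneg_left (h.learn hl0 hl1 hp1 hp2 hlt) hβ0
  simp only [Q]
  nlinarith [this]

lemma Q_swap (h : VInv l0 l1 A K W) (hl0 : l0 ∈ Icc (0:ℝ) 1) (hl1 : l1 ∈ Icc (0:ℝ) 1)
    {p1 p2 : ℝ} (hp1 : p1 ∈ Icc (0:ℝ) 1) :
    Q l0 l1 β Rl Rh Cl Ch W PAct.B2 p1 p2 = Q l0 l1 β Rl Rh Cl Ch W PAct.B1 p2 p1 := by
  have hT1 := Tr_mem hl0 hl1 hp1
  simp only [Q]
  rw [h.sym l1 hl1 _ hT1, h.sym l0 hl0 _ hT1]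

lemma Bop_sym (h : VInv l0 l1 A K W) (hl0 : l0 ∈ Icc (0:ℝ) 1) (hl1 : l1 ∈ Icc (0:ℝ) 1)
    {x y : ℝ} (hx : x ∈ Icc (0:ℝ) 1) (hy : y ∈ Icc (0:ℝ) 1) :
    Bop l0 l1 β Rl Rh Cl Ch W x y = Bop l0 l1 β Rl Rh Cl Ch W y x := by
  have key : ∀ x ∈ Icc (0:ℝ) 1, ∀ y ∈ Icc (0:ℝ) 1,
      Bop l0 l1 β Rl Rh Cl Ch W x y ≤ Bop l0 l1 β Rl Rh Cl Ch W y x := by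
    intro x hx y hy
    rw [Bop_le_iff]
    intro a
    cases a
    · refine le_trans (le_of_eq ?_) (Q_le_Bop PAct.Bb)
      simp only [Q]
      rw [h.sym l0 hl0 l1 hl1]
      ring
    · rw [← Q_swap h hl0 hl1 hy]; exact Q_le_Bop _
    · rw [Q_swap h hl0 hl1 hx]; exact Q_le_Bop _
    · refine le_trans (le_of_eq ?_) (Q_le_Bop PAct.Br)
      simp only [Q]
      rw [h.sym _ (Tr_mem hl0 hl1 hx) _ (Tr_mem hl0 hl1 hy)]
  exact le_antisymm (key x hx y hy) (key y hy x hx)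

lemma Q_conv (h : VInv l0 l1 A K W) (hl0 : l0 ∈ Icc (0:ℝ) 1) (hl1 : l1 ∈ Icc (0:ℝ) 1)
    (hβ0 : 0 ≤ β) (a : PAct)
    {x y q w : ℝ} (hx : x ∈ Icc (0:ℝ) 1) (hy : y ∈ Icc (0:ℝ) 1) (hq : q ∈ Icc (0:ℝ) 1)
    (hw : w ∈ Icc (0:ℝ) 1) :
    Q l0 l1 β Rl Rh Cl Ch W a (w * y + (1 - w) * x) q ≤
    w * Q l0 l1 β Rl Rh Cl Ch W a y q + (1 - w) * Q l0 l1 β Rl Rh Cl Ch W a x q := by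
  have hTx := Tr_mem hl0 hl1 hx
  have hTy := Tr_mem hl0 hl1 hy
  have hT : Tr l0 l1 (w * y + (1 - w) * x) = w * Tr l0 l1 y + (1 - w) * Tr l0 l1 x := by
    unfold Tr; ring
  cases a
  · simp only [Q]; apply le_of_eq; ring
  · simp only [Q]; apply le_of_eq; ring
  · simp only [Q]; rw [hT]
    have := mul_le_mul_of_nonneg_left (avg_le hq (h.conv _ hTx _ hTy l1 hl1 w hw)
      (h.conv _ hTx _ hTy l0 hl0 w hw)) hβ0
    linarith
  · simp only [Q]; rw [hT]
    have := mul_le_mul_of_nonneg_left (h.conv _ hTx _ hTy _ (Tr_mem hl0 hl1 hq) w hw) hβ0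
    linarith

lemma Q_monolip (h : VInv l0 l1 (Rh + Ch) K W) (hl0 : l0 ∈ Icc (0:ℝ) 1)
    (hl1 : l1 ∈ Icc (0:ℝ) 1) (hl01 : l0 < l1)
    (hβ0 : 0 ≤ β) (hRl : 0 < Rl) (hCl : 0 < Cl) (hRlh : Rl < Rh) (hClh : Cl < Ch)
    (hK : K = Rh + Ch + β * (K * (l1 - l0))) (a : PAct)
    {x y q : ℝ} (hx : x ∈ Icc (0:ℝ) 1) (hy : y ∈ Icc (0:ℝ) 1) (hq : q ∈ Icc (0:ℝ) 1)
    (hxy : x ≤ y) :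
    Q l0 l1 β Rl Rh Cl Ch W a x q ≤ Q l0 l1 β Rl Rh Cl Ch W a y q ∧
    Q l0 l1 β Rl Rh Cl Ch W a y q ≤ Q l0 l1 β Rl Rh Cl Ch W a x q + K * (y - x) := by
  have hTx := Tr_mem hl0 hl1 hx
  have hTy := Tr_mem hl0 hl1 hy
  have hTq := Tr_mem hl0 hl1 hq
  have hyx : 0 ≤ y - x := by linarith
  have hTle : Tr l0 l1 x ≤ Tr l0 l1 y := by unfold Tr; nlinarith
  have hTs : Tr l0 l1 y - Tr l0 l1 x = (l1 - l0) * (y - x) := by unfold Tr; ring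
  have hAyx : 0 ≤ (Rh + Ch) * (y - x) := mul_nonneg (by linarith) hyx
  have hKyx : K * (y - x) = (Rh + Ch) * (y - x) + β * (K * (l1 - l0)) * (y - x) := by
    linear_combination (y - x) * hK
  cases a
  · have m1 := h.mono _ hl0 _ hl1 l1 hl1 hl01.le
    have m0 := h.mono _ hl0 _ hl1 l0 hl0 hl01.le
    have k1 := h.lip _ hl0 _ hl1 l1 hl1 hl01.le
    have k0 := h.lip _ hl0 _ hl1 l0 hl0 hl01.le
    have a1 := mul_nonneg (mul_nonneg hβ0 (sub_nonneg.2 (avg_le hq m1 m0))) hyx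
    have a2 := mul_nonneg (mul_nonneg hβ0 (sub_nonneg.2 (avg_le hq k1 k0))) hyx
    have a3 : 0 ≤ (Rl + Cl) * (y - x) := mul_nonneg (by linarith) hyx
    have a4 : 0 ≤ (Rh + Ch - (Rl + Cl)) * (y - x) := mul_nonneg (by linarith) hyx
    rw [hKyx]
    simp only [Q]
    constructor <;> nlinarith [a1, a2, a3, a4]
  · have m1 := h.mono _ hl0 _ hl1 _ hTq hl01.le
    have k1 := h.lip _ hl0 _ hl1 _ hTq hl01.le
    have a1 := mul_nonneg (mul_nonneg hβ0 (sub_nonneg.2 m1)) hyx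
    have a2 := mul_nonneg (mul_nonneg hβ0 (sub_nonneg.2 k1)) hyx
    rw [hKyx]
    simp only [Q]
    constructor <;> nlinarith [a1, a2]
  · have m1 := h.mono _ hTx _ hTy l1 hl1 hTle
    have m0 := h.mono _ hTx _ hTy l0 hl0 hTle
    have k1 := h.lip _ hTx _ hTy l1 hl1 hTle
    have k0 := h.lip _ hTx _ hTy l0 hl0 hTle
    rw [hTs] at k1 k0
    have a1 := mul_le_mul_of_nonneg_left (avg_le hq m1 m0) hβ0
    have a2 := mul_le_mul_of_nonneg_left (avg_le hq k1 k0) hβ0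
    rw [hKyx]
    simp only [Q]
    constructor <;> nlinarith [a1, a2]
  · have m1 := h.mono _ hTx _ hTy _ hTq hTle
    have k1 := h.lip _ hTx _ hTy _ hTq hTle
    rw [hTs] at k1
    have a1 := mul_le_mul_of_nonneg_left m1 hβ0
    have a2 := mul_le_mul_of_nonneg_left k1 hβ0
    rw [hKyx]
    simp only [Q]
    constructor <;> nlinarith [a1, a2]

/-- Using `Bb` or `B1` never loses more than `Rh + Ch`. -/
lemma Q_loss (h : VInv l0 l1 (Rh + Ch) K W) (hl0 : l0 ∈ Icc (0:ℝ) 1)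
    (hl1 : l1 ∈ Icc (0:ℝ) 1)
    (hβ0 : 0 ≤ β) (hβ1 : β < 1) (hRl : 0 < Rl) (hCl : 0 < Cl) (hRlh : Rl < Rh)
    (hClh : Cl < Ch) (hCh2 : Ch < 2 * Cl) (hRlCl : Cl < Rl)
    (a b : PAct) (ha : a = PAct.Bb ∨ a = PAct.B1)
    {x q : ℝ} (hx : x ∈ Icc (0:ℝ) 1) (hq : q ∈ Icc (0:ℝ) 1) :
    Q l0 l1 β Rl Rh Cl Ch W b x q ≤ Q l0 l1 β Rl Rh Cl Ch W a x q + (Rh + Ch) := by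
  have hTx := Tr_mem hl0 hl1 hx
  have hTq := Tr_mem hl0 hl1 hq
  have r1 := mul_le_mul_of_nonneg_left (h.convT hl0 hl1 hTq hx) hβ0
  have c1 := mul_le_mul_of_nonneg_left (avg_le hx (h.convT2 hl0 hl1 hl1 hq)
    (h.convT2 hl0 hl1 hl0 hq)) hβ0
  have c2 := mul_le_mul_of_nonneg_left (avg_le hq (h.convT hl0 hl1 hl1 hx)
    (h.convT hl0 hl1 hl0 hx)) hβ0
  have d1 := h.dfc q hq l1 (Or.inr rfl)
  have d0 := h.dfc q hq l0 (Or.inl rfl)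
  rw [h.sym _ hTq l1 hl1, h.sym l0 hl0 l1 hl1] at d1
  rw [h.sym _ hTq l0 hl0, h.sym l1 hl1 l0 hl0] at d0
  have d := mul_le_mul_of_nonneg_left (avg_le hx d1 d0) hβ0
  have hA : 0 ≤ (1 - q) * (Rh + Ch) := mul_nonneg (by linarith [hq.2]) (by linarith)
  have hb : β * ((1 - q) * (Rh + Ch)) ≤ (1 - q) * (Rh + Ch) := by nlinarith
  have x1 : 0 ≤ x * (Rh + Ch - (Rl + Cl)) := mul_nonneg hx.1 (by linarith)
  have x2 : 0 ≤ (1 - x) * (Rh + Ch - (Rl + Cl)) :=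
    mul_nonneg (by linarith [hx.2]) (by linarith)
  have q2 : 0 ≤ (1 - q) * (Rh + Ch - (Rl + Cl)) :=
    mul_nonneg (by linarith [hq.2]) (by linarith)
  have q1 : 0 ≤ q * (Rh + Ch - (Rl + Cl)) := mul_nonneg hq.1 (by linarith)
  have x3 : 0 ≤ x * (Rl + Cl) := mul_nonneg hx.1 (by linarith)
  have q3 : 0 ≤ q * (Rl + Cl) := mul_nonneg hq.1 (by linarith)
  rcases ha with rfl | rfl <;> cases b <;> simp only [Q] <;> linarith

lemma VInv.step (h : VInv l0 l1 (Rh + Ch) K W) (hl0 : l0 ∈ Icc (0:ℝ) 1)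
    (hl1 : l1 ∈ Icc (0:ℝ) 1) (hl01 : l0 < l1)
    (hβ0 : 0 ≤ β) (hβ1 : β < 1) (hRl : 0 < Rl) (hCl : 0 < Cl) (hRlh : Rl < Rh)
    (hClh : Cl < Ch) (hCh2 : Ch < 2 * Cl) (hRlCl : Cl < Rl) (hRhCh : Ch < Rh)
    (hK : K = Rh + Ch + β * (K * (l1 - l0))) :
    VInv l0 l1 (Rh + Ch) K (Bop l0 l1 β Rl Rh Cl Ch W) := by
  have hmono : ∀ x ∈ Icc (0:ℝ) 1, ∀ y ∈ Icc (0:ℝ) 1, ∀ q ∈ Icc (0:ℝ) 1, x ≤ y →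
      Bop l0 l1 β Rl Rh Cl Ch W x q ≤ Bop l0 l1 β Rl Rh Cl Ch W y q := by
    intro x hx y hy q hq hxy
    rw [Bop_le_iff]
    intro a
    exact (Q_monolip h hl0 hl1 hl01 hβ0 hRl hCl hRlh hClh hK a hx hy hq hxy).1.trans
      (Q_le_Bop a)
  have hlip : ∀ x ∈ Icc (0:ℝ) 1, ∀ y ∈ Icc (0:ℝ) 1, ∀ q ∈ Icc (0:ℝ) 1, x ≤ y →
      Bop l0 l1 β Rl Rh Cl Ch W y q ≤ Bop l0 l1 β Rl Rh Cl Ch W x q + K * (y - x) := by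
    intro x hx y hy q hq hxy
    rw [Bop_le_iff]
    intro a
    have h1 := (Q_monolip h hl0 hl1 hl01 hβ0 hRl hCl hRlh hClh hK a hx hy hq hxy).2
    have h2 := Q_le_Bop (l0 := l0) (l1 := l1) (β := β) (Rl := Rl) (Rh := Rh) (Cl := Cl)
      (Ch := Ch) (W := W) (p1 := x) (p2 := q) a
    linarith
  refine ⟨fun x hx y hy => Bop_sym h hl0 hl1 hx hy, ?_, hmono, hlip, ?_⟩
  · intro x hx y hy q hq w hw
    rw [Bop_le_iff]
    intro a
    exact (Q_conv h hl0 hl1 hβ0 a hx hy hq hw).trans (avg_le hw (Q_le_Bop a) (Q_le_Bop a))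
  · intro c hc q hq
    have hqm : q ∈ Icc (0:ℝ) 1 := by rcases hq with rfl | rfl <;> assumption
    have hTc := Tr_mem hl0 hl1 hc
    by_cases hd : l1 - l0 ≤ 1 / 2
    · have hTl : Tr l0 l1 c ≤ l1 := by unfold Tr; nlinarith [hc.2]
      have e1 := hlip _ hTc _ hl1 q hqm hTl
      have e2 := hmono _ hl0 _ hl1 q hqm hl01.le
      have e3 : l1 - Tr l0 l1 c = (1 - c) * (l1 - l0) := by unfold Tr; ring
      rw [e3] at e1
      have hc1 : 0 ≤ 1 - c := by linarith [hc.2]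
      have hKδ : K * (l1 - l0) ≤ Rh + Ch := by
        have hb : β * (l1 - l0) ≤ 1 / 2 := by nlinarith
        have hKpos : 0 ≤ K := by
          by_contra hneg
          nlinarith
        nlinarith
      have := mul_le_mul_of_nonneg_left hKδ hc1
      have := mul_le_mul_of_nonneg_left e2 hc1
      linarith
    · have hl1h : 1 / 2 < l1 := by linarith [hl0.1]
      have hpos : 0 ≤ (Rh + Ch) * l1 - Ch := by nlinarith
      have hBr : Q l0 l1 β Rl Rh Cl Ch W PAct.Br l1 q ≤
          Q l0 l1 β Rl Rh Cl Ch W PAct.B1 l1 q := by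
        have := mul_le_mul_of_nonneg_left
          (h.convT hl0 hl1 (Tr_mem hl0 hl1 hqm) hl1) hβ0
        simp only [Q]
        linarith
      have hB2 : Q l0 l1 β Rl Rh Cl Ch W PAct.B2 l1 q ≤
          Q l0 l1 β Rl Rh Cl Ch W PAct.B1 l1 q := by
        rcases hq with rfl | rfl
        · have := Q_B1_le_B2 (Rl := Rl) (Cl := Cl) h hl0 hl1 hβ0 hl0 hl1 hl01
          rw [Q_swap h hl0 hl1 hl0] at this
          rw [Q_swap h hl0 hl1 hl1]
          have hh : 0 ≤ (l1 - q) * (Rh + Ch) * (1 - β) :=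
            mul_nonneg (mul_nonneg (by linarith) (by linarith)) (by linarith)
          linarith
        · rw [Q_swap h hl0 hl1 hl1]
      obtain ⟨a, ha, hle⟩ : ∃ a, (a = PAct.Bb ∨ a = PAct.B1) ∧
          Bop l0 l1 β Rl Rh Cl Ch W l1 q ≤ Q l0 l1 β Rl Rh Cl Ch W a l1 q := by
        rcases le_total (Q l0 l1 β Rl Rh Cl Ch W PAct.Bb l1 q)
          (Q l0 l1 β Rl Rh Cl Ch W PAct.B1 l1 q) with hh | hh
        · refine ⟨PAct.B1, Or.inr rfl, ?_⟩
          rw [Bop_le_iff]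
          intro b
          cases b <;> linarith
        · refine ⟨PAct.Bb, Or.inl rfl, ?_⟩
          rw [Bop_le_iff]
          intro b
          cases b <;> linarith
      have h0 : Bop l0 l1 β Rl Rh Cl Ch W l0 q ≤
          Q l0 l1 β Rl Rh Cl Ch W a l0 q + (Rh + Ch) := by
        rw [Bop_le_iff]
        intro b
        exact Q_loss h hl0 hl1 hβ0 hβ1 hRl hCl hRlh hClh hCh2 hRlCl a b ha hl0 hqm
      have haff : Q l0 l1 β Rl Rh Cl Ch W a (Tr l0 l1 c) q =
          c * Q l0 l1 β Rl Rh Cl Ch W a l1 q + (1 - c) * Q l0 l1 β Rl Rh Cl Ch W a l0 q := by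
        have : Tr l0 l1 c = c * l1 + (1 - c) * l0 := by unfold Tr; ring
        rw [this]
        rcases ha with rfl | rfl <;> simp only [Q] <;> ring
      have h1 := avg_le hc hle h0
      have h2 := Q_le_Bop (l0 := l0) (l1 := l1) (β := β) (Rl := Rl) (Rh := Rh) (Cl := Cl)
        (Ch := Ch) (W := W) (p1 := Tr l0 l1 c) (p2 := q) a
      linarith

lemma Q_contract {V : ℝ → ℝ → ℝ} {ε : ℝ} (hl0 : l0 ∈ Icc (0:ℝ) 1)
    (hl1 : l1 ∈ Icc (0:ℝ) 1) (hβ0 : 0 ≤ β)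
    (h : ∀ x ∈ Icc (0:ℝ) 1, ∀ y ∈ Icc (0:ℝ) 1, W x y ≤ V x y + ε) (a : PAct)
    {x y : ℝ} (hx : x ∈ Icc (0:ℝ) 1) (hy : y ∈ Icc (0:ℝ) 1) :
    Q l0 l1 β Rl Rh Cl Ch W a x y ≤ Q l0 l1 β Rl Rh Cl Ch V a x y + β * ε := by
  have hTx := Tr_mem hl0 hl1 hx
  have hTy := Tr_mem hl0 hl1 hy
  cases a
  · have := mul_le_mul_of_nonneg_left (avg_le hx
      (avg_le hy (h _ hl1 _ hl1) (h _ hl1 _ hl0))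
      (avg_le hy (h _ hl0 _ hl1) (h _ hl0 _ hl0))) hβ0
    simp only [Q]
    linarith
  · have := mul_le_mul_of_nonneg_left (avg_le hx (h _ hl1 _ hTy) (h _ hl0 _ hTy)) hβ0
    simp only [Q]
    linarith
  · have := mul_le_mul_of_nonneg_left (avg_le hy (h _ hTx _ hl1) (h _ hTx _ hl0)) hβ0
    simp only [Q]
    linarith
  · have := mul_le_mul_of_nonneg_left (h _ hTx _ hTy) hβ0
    simp only [Q]
    linarith

lemma Bop_contract {V : ℝ → ℝ → ℝ} {ε : ℝ} (hl0 : l0 ∈ Icc (0:ℝ) 1)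
    (hl1 : l1 ∈ Icc (0:ℝ) 1) (hβ0 : 0 ≤ β)
    (h : ∀ x ∈ Icc (0:ℝ) 1, ∀ y ∈ Icc (0:ℝ) 1, W x y ≤ V x y + ε)
    {x y : ℝ} (hx : x ∈ Icc (0:ℝ) 1) (hy : y ∈ Icc (0:ℝ) 1) :
    Bop l0 l1 β Rl Rh Cl Ch W x y ≤ Bop l0 l1 β Rl Rh Cl Ch V x y + β * ε := by
  rw [Bop_le_iff]
  intro a
  exact (Q_contract hl0 hl1 hβ0 h a hx hy).trans (add_le_add (Q_le_Bop a) le_rfl)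

lemma VInv.limit {F : ℕ → ℝ → ℝ → ℝ} {V : ℝ → ℝ → ℝ} (hl0 : l0 ∈ Icc (0:ℝ) 1)
    (hl1 : l1 ∈ Icc (0:ℝ) 1) (hF : ∀ n, VInv l0 l1 A K (F n))
    (hlim : ∀ x ∈ Icc (0:ℝ) 1, ∀ y ∈ Icc (0:ℝ) 1,
      Filter.Tendsto (fun n => F n x y) Filter.atTop (nhds (V x y))) :
    VInv l0 l1 A K V := by
  refine ⟨?_, ?_, ?_, ?_, ?_⟩
  · intro x hx y hy
    refine tendsto_nhds_unique (hlim x hx y hy) ?_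
    refine (hlim y hy x hx).congr fun n => ?_
    exact (hF n).sym y hy x hx
  · intro x hx y hy q hq w hw
    exact le_of_tendsto_of_tendsto' (hlim _ (comb_mem hx hy hw) q hq)
      (((hlim y hy q hq).const_mul w).add ((hlim x hx q hq).const_mul (1 - w)))
      fun n => (hF n).conv x hx y hy q hq w hw
  · intro x hx y hy q hq hxy
    exact le_of_tendsto_of_tendsto' (hlim x hx q hq) (hlim y hy q hq)
      fun n => (hF n).mono x hx y hy q hq hxy
  · intro x hx y hy q hq hxy
    exact le_of_tendsto_of_tendsto' (hlim y hy q hq) ((hlim x hx q hq).add_const _)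
      fun n => (hF n).lip x hx y hy q hq hxy
  · intro c hc q hq
    have hqm : q ∈ Icc (0:ℝ) 1 := by rcases hq with rfl | rfl <;> assumption
    exact le_of_tendsto' ((((hlim l1 hl1 q hqm).const_mul c).add
      ((hlim l0 hl0 q hqm).const_mul (1 - c))).sub (hlim _ (Tr_mem hl0 hl1 hc) q hqm))
      fun n => (hF n).dfc c hc q hq

end

/-- Theorem 3 (part): the gambling regions lie on their side of the diagonal. -/
theorem gambling_regions_diagonal
    (l0 l1 β Rl Rh Cl Ch : ℝ)
    (hl0 : l0 ∈ Icc (0:ℝ) 1) (hl1 : l1 ∈ Icc (0:ℝ) 1) (hl01 : l0 < l1)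
    (hβ0 : 0 ≤ β) (hβ1 : β < 1)
    (hRl : 0 < Rl) (hRh : 0 < Rh) (hCl : 0 < Cl) (hCh : 0 < Ch)
    (hRlh : Rl < Rh) (hRh2 : Rh < 2 * Rl)
    (hClh : Cl < Ch) (hCh2 : Ch < 2 * Cl)
    (hRhCh : Ch < Rh) (hRlCl : Cl < Rl)
    (V : ℝ → ℝ → ℝ) (hVbdd : BddOnSq V)
    (hVfix : IsFix l0 l1 β Rl Rh Cl Ch V) :
    (∀ p : ℝ × ℝ, p ∈ Phi l0 l1 β Rl Rh Cl Ch V PAct.B1 → p.2 ≤ p.1) ∧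
    (∀ p : ℝ × ℝ, p ∈ Phi l0 l1 β Rl Rh Cl Ch V PAct.B2 → p.1 ≤ p.2) := by
  obtain ⟨K, hK⟩ : ∃ K, K = Rh + Ch + β * (K * (l1 - l0)) := by
    have hb : β * (l1 - l0) < 1 := by
      have : l1 - l0 ≤ 1 := by linarith [hl0.1, hl1.2]
      nlinarith
    have hb' : (1 - β * (l1 - l0)) ≠ 0 := by linarith
    refine ⟨(Rh + Ch) / (1 - β * (l1 - l0)), ?_⟩
    field_simp
    ring
  have hKpos : 0 ≤ K := by
    have hb : β * (l1 - l0) < 1 := by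
      have : l1 - l0 ≤ 1 := by linarith [hl0.1, hl1.2]
      nlinarith
    by_contra hneg
    nlinarith
  obtain ⟨M, hM⟩ := hVbdd
  let F : ℕ → ℝ → ℝ → ℝ := fun n => (Bop l0 l1 β Rl Rh Cl Ch)^[n] (fun _ _ => 0)
  have hFs : ∀ n, F (n + 1) = Bop l0 l1 β Rl Rh Cl Ch (F n) := fun n =>
    Function.iterate_succ_apply' _ _ _
  have hF : ∀ n, VInv l0 l1 (Rh + Ch) K (F n) := by
    intro n
    induction n with
    | zero =>
      refine ⟨?_, ?_, ?_, ?_, ?_⟩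
      · intros; rfl
      · intros; simp [F]
      · intros; simp [F]
      · intro x hx y hy q hq hxy
        simp only [F, Function.iterate_zero, id_eq, zero_add]
        exact mul_nonneg hKpos (by linarith)
      · intro c hc q hq
        simp only [F, Function.iterate_zero, id_eq, mul_zero, add_zero, sub_zero]
        exact mul_nonneg (by linarith [hc.2]) (by linarith)
    | succ n ih =>
      rw [hFs]
      exact ih.step hl0 hl1 hl01 hβ0 hβ1 hRl hCl hRlh hClh hCh2 hRlCl hRhCh hK
  have hcl : ∀ n, (∀ x ∈ Icc (0:ℝ) 1, ∀ y ∈ Icc (0:ℝ) 1, F n x y ≤ V x y + β ^ n * M) ∧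
      (∀ x ∈ Icc (0:ℝ) 1, ∀ y ∈ Icc (0:ℝ) 1, V x y ≤ F n x y + β ^ n * M) := by
    intro n
    induction n with
    | zero =>
      constructor
      · intro x hx y hy
        have := abs_le.1 (hM x hx y hy)
        simp only [F, Function.iterate_zero, id_eq, pow_zero, one_mul]
        linarith [this.1]
      · intro x hx y hy
        have := abs_le.1 (hM x hx y hy)
        simp only [F, Function.iterate_zero, id_eq, pow_zero, one_mul]
        linarith [this.2]
    | succ n ih =>
      rw [hFs]
      constructor
      · intro x hx y hy
        rw [hVfix x hx y hy, pow_succ', mul_assoc]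
        exact Bop_contract hl0 hl1 hβ0 ih.1 hx hy
      · intro x hx y hy
        rw [hVfix x hx y hy, pow_succ', mul_assoc]
        exact Bop_contract hl0 hl1 hβ0 ih.2 hx hy
  have hlim : ∀ x ∈ Icc (0:ℝ) 1, ∀ y ∈ Icc (0:ℝ) 1,
      Filter.Tendsto (fun n => F n x y) Filter.atTop (nhds (V x y)) := by
    intro x hx y hy
    have hz : Filter.Tendsto (fun n : ℕ => β ^ n * M) Filter.atTop (nhds 0) := by
      simpa using (tendsto_pow_atTop_nhds_zero_of_lt_one hβ0 hβ1).mul_const M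
    have u1 : Filter.Tendsto (fun n : ℕ => V x y - β ^ n * M) Filter.atTop
        (nhds (V x y)) := by simpa using hz.const_sub (V x y)
    have u2 : Filter.Tendsto (fun n : ℕ => V x y + β ^ n * M) Filter.atTop
        (nhds (V x y)) := by simpa using hz.const_add (V x y)
    refine tendsto_of_tendsto_of_tendsto_of_le_of_le u1 u2 ?_ ?_
    · intro n
      have := (hcl n).2 x hx y hy
      show V x y - β ^ n * M ≤ F n x y
      linarith
    · intro n
      exact (hcl n).1 x hx y hy
  have hV : VInv l0 l1 (Rh + Ch) K V := VInv.limit hl0 hl1 hF hlim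
  constructor
  · rintro ⟨p1, p2⟩ ⟨h1, h2, he⟩
    simp only at h1 h2 he ⊢
    by_contra! hlt
    have k1 := Q_B1_le_B2 (Rl := Rl) (Cl := Cl) hV hl0 hl1 hβ0 h1 h2 hlt
    have k2 : Q l0 l1 β Rl Rh Cl Ch V PAct.B2 p1 p2 ≤ V p1 p2 := by
      rw [hVfix p1 h1 p2 h2]; exact Q_le_Bop _
    have k3 : 0 < (p2 - p1) * (Rh + Ch) * (1 - β) :=
      mul_pos (mul_pos (by linarith) (by linarith)) (by linarith)
    linarith
  · rintro ⟨p1, p2⟩ ⟨h1, h2, he⟩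
    simp only at h1 h2 he ⊢
    by_contra! hlt
    have k1 := Q_B1_le_B2 (Rl := Rl) (Cl := Cl) hV hl0 hl1 hβ0 h2 h1 hlt
    rw [Q_swap hV hl0 hl1 h2, ← Q_swap hV hl0 hl1 h1] at k1
    have k2 : Q l0 l1 β Rl Rh Cl Ch V PAct.B1 p1 p2 ≤ V p1 p2 := by
      rw [hVfix p1 h1 p2 h2]; exact Q_le_Bop _
    have k3 : 0 < (p1 - p2) * (Rh + Ch) * (1 - β) :=
      mul_pos (mul_pos (by linarith) (by linarith)) (by linarith)
    linarith
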